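/- arXiv:2309.08716 — 4 statements merged into one kernel-verified Lean document; each statement's English description precedes it below -/
import Mathlib

section
/- Let q ≥ 1 and g ≥ 1 be natural numbers and set p = log₂(q) + 4·(2 + log₂(g+1)) (a real number). Then for every integer ℓ ≥ 1, q · C_{2^{ℓ+2}} · (g+1)^{2^{ℓ+2}} ≤ 2^{p · 2^ℓ}, where the right-hand side is a real power of 2. (This is the counting estimate from Lemma 3.2: a real-time deterministic tree-walking-storage automaton with q states and g tree symbols can access at most 2^{ℓ+2} tree nodes in its last ℓ+1 steps, so the number of ℓ-equivalence classes it can distinguish is at most q · C_{2^{ℓ+2}} · (g+1)^{2^{ℓ+2}} ≤ 2^{p·2^ℓ}.) -/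
theorem catalan_le_four_pow (n : ℕ) : catalan n ≤ 4 ^ n :=
  calc
    catalan n ≤ n.centralBinom := by
      rw [catalan_eq_centralBinom_div]
      exact Nat.div_le_self _ _
    _ ≤ 4 ^ n := Nat.centralBinom_le_four_pow n

theorem two_rpow_logb_add_four_mul {x y : ℝ} (hx : 0 < x) (hy : 0 < y) :
    (2 : ℝ) ^ (Real.logb 2 x + 4 * (2 + Real.logb 2 y)) = x * (4 * y) ^ 4 := by
  rw [Real.rpow_add two_pos, Real.rpow_logb two_pos (by norm_num) hx,
    mul_comm (4 : ℝ) (2 + _), Real.rpow_mul two_pos.le, Real.rpow_add two_pos,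
    Real.rpow_logb two_pos (by norm_num) hy]
  norm_num

open Real in
theorem equivalence_classes_bound (q g : ℕ) (hq : 1 ≤ q) (hg : 1 ≤ g)
    (p : ℝ) (hp : p = Real.logb 2 q + 4 * (2 + Real.logb 2 (g + 1)))
    (ℓ : ℕ) (hℓ : 1 ≤ ℓ) :
    (q * catalan (2 ^ (ℓ + 2)) * (g + 1) ^ (2 ^ (ℓ + 2)) : ℝ) ≤
      (2 : ℝ) ^ (p * 2 ^ ℓ) := by
  have hq' : (1 : ℝ) ≤ q := by exact_mod_cast hq
  have hcat : (catalan (2 ^ (ℓ + 2)) : ℝ) ≤ 4 ^ 2 ^ (ℓ + 2) := by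
    exact_mod_cast catalan_le_four_pow _
  have hrhs : (2 : ℝ) ^ (p * 2 ^ ℓ) = (q * (4 * (g + 1)) ^ 4 : ℝ) ^ 2 ^ ℓ := by
    rw [rpow_mul two_pos.le, hp, two_rpow_logb_add_four_mul (by positivity) (by positivity),
      ← rpow_natCast _ (2 ^ ℓ)]
    push_cast
    rfl
  rw [hrhs]
  calc
    (q * catalan (2 ^ (ℓ + 2)) * (g + 1) ^ (2 ^ (ℓ + 2)) : ℝ)
        ≤ q ^ 2 ^ ℓ * 4 ^ 2 ^ (ℓ + 2) * (g + 1) ^ 2 ^ (ℓ + 2) := by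
      gcongr
      exact le_self_pow₀ hq' (by positivity)
    _ = (q * (4 * (g + 1)) ^ 4 : ℝ) ^ 2 ^ ℓ := by
      rw [mul_pow (q : ℝ), ← pow_mul, mul_pow (4 : ℝ), pow_add 2 ℓ 2, mul_comm (2 ^ ℓ) (2 ^ 2),
        mul_assoc]
      norm_num
end

section
/- Let ℓ ≥ 1 be an integer, and let P and S be two distinct subsets of {a,b}^{2ℓ} (the set of words of length 2ℓ over {a,b}). Let w_P = $v₁$v₂$⋯$v_k♯ where v₁,…,v_k is any enumeration (without repetition) of the elements of P, and define w_S analogously from an enumeration of S. Then there exists a word u over {α₀,α₁,α₂,α₃} with |u| = ℓ such that exactly one of the two words w_P·u and w_S·u belongs to L_h. In particular, w_P and w_S are not ℓ-equivalent with respect to L_h. -/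
/-- The two-letter alphabet `{a, b}`. -/
inductive AB : Type
  | a | b
  deriving DecidableEq

/-- The four-letter alphabet `{α₀, α₁, α₂, α₃}`. -/
inductive Alpha : Type
  | α0 | α1 | α2 | α3
  deriving DecidableEq

/-- The alphabet `Σ_h = {a, b, $, ♯, α₀, α₁, α₂, α₃}`. -/
inductive SymH : Type
  | a | b | dollar | sharp | α0 | α1 | α2 | α3
  deriving DecidableEq

/-- Embedding of `{a,b}` into `Σ_h`. -/
def embAB : AB → SymH
  | AB.a => SymH.a
  | AB.b => SymH.b

/-- Embedding of `{α₀,α₁,α₂,α₃}` into `Σ_h`. -/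
def embAlpha : Alpha → SymH
  | Alpha.α0 => SymH.α0
  | Alpha.α1 => SymH.α1
  | Alpha.α2 => SymH.α2
  | Alpha.α3 => SymH.α3

/-- The homomorphism `h` on single letters: `h(α₀)=aa`, `h(α₁)=ab`,
`h(α₂)=ba`, `h(α₃)=bb`. -/
def hLetter : Alpha → List AB
  | Alpha.α0 => [AB.a, AB.a]
  | Alpha.α1 => [AB.a, AB.b]
  | Alpha.α2 => [AB.b, AB.a]
  | Alpha.α3 => [AB.b, AB.b]

/-- The homomorphism `h : {α₀,α₁,α₂,α₃}* → {a,b}*`. -/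
def hHom (y : List Alpha) : List AB := y.flatMap hLetter

/-- The word `x₁ $ x₂ $ ⋯ $ x_k` over `Σ_h`, for `xs = [x₁,…,x_k]`
a list of words over `{a,b}`. -/
def encodeXs (xs : List (List AB)) : List SymH :=
  ((xs.map (List.map embAB)).intersperse [SymH.dollar]).flatten

/-- The language
`L_h = { x₁ $ x₂ $ ⋯ $ x_k ♯ y : k ≥ 0, xᵢ ∈ {a,b}*, y ∈ {α₀,α₁,α₂,α₃}*,
∃ j, x_j^R = h(y) }`. -/
def Lh : Set (List SymH) :=
  { w | ∃ (xs : List (List AB)) (y : List Alpha),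
      w = encodeXs xs ++ SymH.sharp :: y.map embAlpha ∧
      ∃ x ∈ xs, x.reverse = hHom y }

/-- Two words are `ℓ`-equivalent with respect to a language `L` if appending
any word of length at most `ℓ` to both leads to the same membership status. -/
def EllEquiv {σ : Type} (L : Set (List σ)) (ℓ : ℕ) (w w' : List σ) : Prop :=
  ∀ u : List σ, u.length ≤ ℓ → (w ++ u ∈ L ↔ w' ++ u ∈ L)

theorem List.append_cons_inj_of_notMem_left {α : Type*} {a : α} {x y z w : List α}
    (hx : a ∉ x) (hy : a ∉ y) (h : x ++ a :: z = y ++ a :: w) : x = y ∧ z = w := by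
  induction x generalizing y with
  | nil => cases y <;> grind
  | cons c x ih =>
    cases y with
    | nil => grind
    | cons d y =>
      simp only [List.cons_append, List.cons.injEq] at h
      obtain ⟨rfl, rfl⟩ := ih (List.not_mem_of_not_mem_cons hx)
        (List.not_mem_of_not_mem_cons hy) h.2
      exact ⟨congrArg (· :: x) h.1, rfl⟩

theorem embAB_injective : Function.Injective embAB := by
  rintro (_ | _) (_ | _) h <;> simp_all [embAB]

theorem embAlpha_injective : Function.Injective embAlpha := by
  rintro (_ | _ | _ | _) (_ | _ | _ | _) h <;> simp_all [embAlpha]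

theorem dollar_notMem_map_embAB (x : List AB) : SymH.dollar ∉ x.map embAB := by
  simp only [List.mem_map, not_exists, not_and]
  rintro (_ | _) _ <;> simp [embAB]

theorem sharp_notMem_map_embAB (x : List AB) : SymH.sharp ∉ x.map embAB := by
  simp only [List.mem_map, not_exists, not_and]
  rintro (_ | _) _ <;> simp [embAB]

theorem encodeXs_cons (x : List AB) (xs : List (List AB)) :
    encodeXs (x :: xs) =
      x.map embAB ++ xs.flatMap (fun v => SymH.dollar :: v.map embAB) := by
  induction xs generalizing x with
  | nil => simp [encodeXs]
  | cons y ys ih =>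
    have hy := ih y
    simp only [encodeXs, List.map_cons] at hy
    simp [encodeXs, hy]

theorem sharp_notMem_encodeXs (xs : List (List AB)) : SymH.sharp ∉ encodeXs xs := by
  cases xs with
  | nil => simp [encodeXs]
  | cons x xs =>
    rw [encodeXs_cons]
    simp [-List.mem_map, sharp_notMem_map_embAB]

theorem encodeXs_cons_inj (x y : List AB) (xs ys : List (List AB)) :
    encodeXs (x :: xs) = encodeXs (y :: ys) ↔ x = y ∧ xs = ys := by
  refine ⟨fun h => ?_, by rintro ⟨rfl, rfl⟩; rfl⟩
  rw [encodeXs_cons, encodeXs_cons] at h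
  induction xs generalizing x y ys with
  | nil =>
    cases ys with
    | nil => exact ⟨embAB_injective.list_map (by simpa using h), rfl⟩
    | cons z zs =>
      refine absurd ?_ (dollar_notMem_map_embAB x)
      simp only [List.flatMap_nil, List.append_nil] at h
      rw [h]
      simp
  | cons x' xs ih =>
    cases ys with
    | nil =>
      refine absurd ?_ (dollar_notMem_map_embAB y)
      simp only [List.flatMap_nil, List.append_nil] at h
      rw [← h]
      simp
    | cons z zs =>
      simp only [List.flatMap_cons, List.cons_append] at h
      obtain ⟨hxy, h⟩ := List.append_cons_inj_of_notMem_left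
        (dollar_notMem_map_embAB x) (dollar_notMem_map_embAB y) h
      obtain ⟨rfl, rfl⟩ := ih _ _ _ h
      exact ⟨embAB_injective.list_map hxy, rfl⟩

theorem encodeXs_append_sharp_mem_Lh_iff (x : List AB) (xs : List (List AB)) (u : List Alpha) :
    encodeXs (x :: xs) ++ SymH.sharp :: u.map embAlpha ∈ Lh ↔ (hHom u).reverse ∈ x :: xs := by
  constructor
  · rintro ⟨ys, y, h, z, hz, hzy⟩
    obtain ⟨henc, hu⟩ := List.append_cons_inj_of_notMem_left
      (sharp_notMem_encodeXs _) (sharp_notMem_encodeXs _) h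
    obtain rfl := embAlpha_injective.list_map hu
    cases ys with
    | nil => simp at hz
    | cons y' ys =>
      obtain ⟨rfl, rfl⟩ := (encodeXs_cons_inj _ _ _ _).1 henc
      rwa [← hzy, List.reverse_reverse]
  · exact fun h => ⟨_, u, rfl, _, h, List.reverse_reverse _⟩

theorem length_hHom (u : List Alpha) : (hHom u).length = 2 * u.length := by
  induction u with
  | nil => rfl
  | cons c u ih =>
    have hc : (hLetter c).length = 2 := by cases c <;> rfl
    simp only [hHom] at ih
    simp only [hHom, List.flatMap_cons, List.length_append, List.length_cons, ih, hc]
    omega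

theorem exists_hLetter_eq (c d : AB) : ∃ γ, hLetter γ = [c, d] := by
  cases c <;> cases d
  exacts [⟨.α0, rfl⟩, ⟨.α1, rfl⟩, ⟨.α2, rfl⟩, ⟨.α3, rfl⟩]

theorem exists_hHom_eq (n : ℕ) (v : List AB) (hv : v.length = 2 * n) :
    ∃ u : List Alpha, u.length = n ∧ hHom u = v := by
  induction n generalizing v with
  | zero => exact ⟨[], rfl, (List.length_eq_zero_iff.1 hv).symm⟩
  | succ n ih =>
    match v, hv with
    | c :: d :: v, hv =>
      obtain ⟨u, hu, rfl⟩ := ih v (by simp only [List.length_cons] at hv; omega)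
      obtain ⟨γ, hγ⟩ := exists_hLetter_eq c d
      exact ⟨γ :: u, by simp [hu], by simp [hHom, hγ]⟩

theorem flatMap_append_mem_Lh_iff (vs : List (List AB)) {u : List Alpha} (hu : u ≠ []) :
    (vs.flatMap (fun v => SymH.dollar :: v.map embAB) ++ [SymH.sharp]) ++ u.map embAlpha ∈ Lh ↔
      (hHom u).reverse ∈ vs := by
  have h := encodeXs_append_sharp_mem_Lh_iff [] vs u
  have hne : (hHom u).reverse ≠ [] := by
    rw [← List.length_pos_iff, List.length_reverse, length_hHom]
    have := List.length_pos_iff.2 hu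
    omega
  simpa [encodeXs_cons, hne] using h

/-- for distinct subsets `P`, `S` of `{a,b}^{2ℓ}`, the words
`w_P = $v₁$⋯$v_k♯` and `w_S` (built from enumerations of `P` and `S`)
are separated by some word `u ∈ {α₀,α₁,α₂,α₃}^ℓ`; in particular they are not
`ℓ`-equivalent with respect to `L_h`. -/
theorem distinct_subsets_not_equivalent (ℓ : ℕ) (hℓ : 1 ≤ ℓ)
    (P S : Set (List AB))
    (hP : ∀ v ∈ P, v.length = 2 * ℓ) (hS : ∀ v ∈ S, v.length = 2 * ℓ)
    (hPS : P ≠ S)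
    (vs ss : List (List AB)) (hvs : vs.Nodup) (hss : ss.Nodup)
    (hvsP : ∀ v, v ∈ vs ↔ v ∈ P) (hssS : ∀ v, v ∈ ss ↔ v ∈ S)
    (wP wS : List SymH)
    (hwP : wP = (vs.flatMap (fun v => SymH.dollar :: v.map embAB)) ++ [SymH.sharp])
    (hwS : wS = (ss.flatMap (fun v => SymH.dollar :: v.map embAB)) ++ [SymH.sharp]) :
    (∃ u : List Alpha, u.length = ℓ ∧
      Xor' (wP ++ u.map embAlpha ∈ Lh) (wS ++ u.map embAlpha ∈ Lh)) ∧
    ¬ EllEquiv Lh ℓ wP wS := by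
  subst hwP hwS
  have hsep : ∃ u : List Alpha, u.length = ℓ ∧
      Xor' ((hHom u).reverse ∈ P) ((hHom u).reverse ∈ S) := by
    obtain ⟨v, hv⟩ : ∃ v, ¬ (v ∈ P ↔ v ∈ S) := by
      by_contra! h
      exact hPS (Set.ext h)
    have hlen : v.length = 2 * ℓ := by
      by_cases hvP : v ∈ P
      · exact hP v hvP
      · exact hS v (by tauto)
    obtain ⟨u, hu, huv⟩ := exists_hHom_eq ℓ v.reverse (by rw [List.length_reverse, hlen])
    refine ⟨u, hu, ?_⟩
    rw [huv, List.reverse_reverse]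
    exact (xor_iff_not_iff _ _).2 hv
  obtain ⟨u, hu, hxor⟩ := hsep
  have hne : u ≠ [] := List.length_pos_iff.1 (by omega)
  rw [← hvsP, ← hssS, ← flatMap_append_mem_Lh_iff vs hne,
    ← flatMap_append_mem_Lh_iff ss hne] at hxor
  exact ⟨⟨u, hu, hxor⟩, fun h => (xor_iff_not_iff _ _).1 hxor
    (h (u.map embAlpha) (by rw [List.length_map, hu]))⟩
end

section
/- For every integer ℓ ≥ 1 there exists a finite set W of words over Σ_h with |W| = 2^{2^{2ℓ}} whose elements are pairwise not ℓ-equivalent with respect to L_h. That is, L_h induces at least 2^{2^{2ℓ}} ℓ-equivalence classes. -/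
instance : Fintype Alpha where
  elems := {Alpha.α0, Alpha.α1, Alpha.α2, Alpha.α3}
  complete := by rintro (_ | _ | _ | _) <;> simp

theorem hHom_injective : Function.Injective hHom := by
  intro y
  induction y with
  | nil => rintro (_ | ⟨_ | _ | _ | _, z⟩) h <;> simp_all [hHom, hLetter]
  | cons c y ih =>
    rintro (_ | ⟨d, z⟩) h
    · cases c <;> simp [hHom, hLetter] at h
    · have hcd : c = d ∧ hHom y = hHom z := by
        cases c <;> cases d <;> simp_all [hHom, hLetter]
      rw [hcd.1, ih hcd.2]

theorem sharp_notMem_map_embAlpha (y : List Alpha) : SymH.sharp ∉ y.map embAlpha := by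
  simp only [List.mem_map, not_exists, not_and]
  rintro (_ | _ | _ | _) _ h <;> cases h

theorem splitOn_encodeXs {xs : List (List AB)} (hxs : xs ≠ []) :
    (encodeXs xs).splitOn SymH.dollar = xs.map (List.map embAB) := by
  refine List.splitOn_intercalate _ ?_ (by simpa using hxs)
  simp only [List.mem_map]
  rintro _ ⟨x, -, rfl⟩
  exact dollar_notMem_map_embAB x

/-- The encoding determines the nonempty blocks. It does not determine the empty ones, since
`[]` and `[[]]` have the same encoding. -/
theorem mem_of_encodeXs_eq {xs xs' : List (List AB)} (h : encodeXs xs = encodeXs xs')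
    {x : List AB} (hx : x ∈ xs) (hne : x ≠ []) : x ∈ xs' := by
  have hmem : x.map embAB ∈ (encodeXs xs').splitOn SymH.dollar := by
    rw [← h, splitOn_encodeXs (List.ne_nil_of_mem hx)]
    exact List.mem_map_of_mem hx
  rcases eq_or_ne xs' [] with rfl | hxs'
  · exact absurd (by simpa [encodeXs] using hmem) hne
  · rw [splitOn_encodeXs hxs'] at hmem
    exact (List.mem_map_of_injective embAB_injective.list_map).1 hmem

theorem encodeXs_append_mem_Lh_iff (xs : List (List AB)) {y : List Alpha} (hy : y ≠ []) :
    encodeXs xs ++ SymH.sharp :: y.map embAlpha ∈ Lh ↔ (hHom y).reverse ∈ xs := by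
  constructor
  · rintro ⟨xs', y', heq, x, hx, hxy⟩
    obtain ⟨h₁, -, h₂⟩ := (List.append_cons_inj_of_notMem (sharp_notMem_encodeXs xs)
      (sharp_notMem_map_embAlpha y)).1 heq
    obtain rfl := embAlpha_injective.list_map h₂
    obtain rfl : x = (hHom y).reverse := by rw [← hxy, List.reverse_reverse]
    exact mem_of_encodeXs_eq h₁.symm hx fun h =>
      hy (hHom_injective (List.reverse_eq_nil_iff.1 h))
  · exact fun h => ⟨xs, y, rfl, _, h, List.reverse_reverse _⟩

/-- The word `x₁ $ ⋯ $ x_k ♯` whose blocks `xᵢ` are the reversals of `h(y)` for `y ∈ T`. -/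
noncomputable def blockWord {ℓ : ℕ} (T : Finset (List.Vector Alpha ℓ)) : List SymH :=
  encodeXs (T.toList.map fun y => (hHom y.toList).reverse) ++ [SymH.sharp]

theorem blockWord_append_mem_Lh_iff {ℓ : ℕ} (hℓ : 1 ≤ ℓ) (T : Finset (List.Vector Alpha ℓ))
    (y : List.Vector Alpha ℓ) : blockWord T ++ y.toList.map embAlpha ∈ Lh ↔ y ∈ T := by
  have hy : y.toList ≠ [] := by
    rw [← List.length_pos_iff, y.toList_length]
    exact hℓ
  have hinj : Function.Injective fun y : List.Vector Alpha ℓ => (hHom y.toList).reverse :=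
    List.reverse_injective.comp (hHom_injective.comp List.Vector.toList_injective)
  rw [blockWord, List.append_assoc, List.singleton_append, encodeXs_append_mem_Lh_iff _ hy,
    ← Finset.mem_toList]
  exact List.mem_map_of_injective hinj

theorem eq_of_ellEquiv_blockWord {ℓ : ℕ} (hℓ : 1 ≤ ℓ) {T T' : Finset (List.Vector Alpha ℓ)}
    (h : EllEquiv Lh ℓ (blockWord T) (blockWord T')) : T = T' := by
  ext y
  rw [← blockWord_append_mem_Lh_iff hℓ, ← blockWord_append_mem_Lh_iff hℓ]
  exact h _ (by simp)

/-- `L_h` induces at least `2^(2^(2ℓ))` `ℓ`-equivalence classes: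
there is a set of `2^(2^(2ℓ))` words that are pairwise not `ℓ`-equivalent
with respect to `L_h`. -/
theorem Lh_many_equivalence_classes (ℓ : ℕ) (hℓ : 1 ≤ ℓ) :
    ∃ W : Finset (List SymH), W.card = 2 ^ (2 ^ (2 * ℓ)) ∧
      ∀ w ∈ W, ∀ w' ∈ W, w ≠ w' → ¬ EllEquiv Lh ℓ w w' := by
  have hinj : Function.Injective (blockWord (ℓ := ℓ)) := fun T T' h =>
    eq_of_ellEquiv_blockWord hℓ fun u _ => by rw [h]
  refine ⟨Finset.univ.map ⟨blockWord, hinj⟩, ?_, ?_⟩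
  · have hcard : Fintype.card Alpha = 4 := rfl
    rw [Finset.card_map, Finset.card_univ, Fintype.card_finset, card_vector, hcard, pow_mul]
    norm_num
  · simp only [Finset.mem_map, Finset.mem_univ, true_and, Function.Embedding.coeFn_mk]
    rintro _ ⟨T, rfl⟩ _ ⟨T', rfl⟩ hne h
    exact hne (congrArg blockWord (eq_of_ellEquiv_blockWord hℓ h))
end

section
/- With the alphabets Σ₁ = {α₀, α₁, α₂, α₃, a, b, $, ♯} and Σ₂ = {a, b, $, ♯, a', b'}, the homomorphism h₂, and the languages L̃_h ⊆ Σ₁* and L̃_p ⊆ Σ₂* defined in the context, the inverse homomorphic image satisfies h₂⁻¹(L̃_p) = L̃_h; that is, for every word w ∈ Σ₁*, h₂(w) ∈ L̃_p if and only if w ∈ L̃_h. -/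
/-- The two-letter primed alphabet `{a', b'}`. -/
inductive ABP : Type
  | ap | bp
  deriving DecidableEq

/-- The alphabet `Σ₁ = {α₀, α₁, α₂, α₃, a, b, $, ♯}`. -/
inductive Sig1 : Type
  | α0 | α1 | α2 | α3 | a | b | dollar | sharp
  deriving DecidableEq

/-- The alphabet `Σ₂ = {a, b, $, ♯, a', b'}`. -/
inductive Sig2 : Type
  | a | b | dollar | sharp | ap | bp
  deriving DecidableEq

/-- The homomorphism `h₁ : {a',b'}* → {a,b}*` on letters: `h₁(a')=a`, `h₁(b')=b`. -/
def h1Letter : ABP → AB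
  | ABP.ap => AB.a
  | ABP.bp => AB.b

/-- Embedding of `{a,b}` into `Σ₁`. -/
def emb1AB : AB → Sig1
  | AB.a => Sig1.a
  | AB.b => Sig1.b

/-- Embedding of `{α₀,α₁,α₂,α₃}` into `Σ₁`. -/
def emb1Alpha : Alpha → Sig1
  | Alpha.α0 => Sig1.α0
  | Alpha.α1 => Sig1.α1
  | Alpha.α2 => Sig1.α2
  | Alpha.α3 => Sig1.α3

/-- Embedding of `{a,b}` into `Σ₂`. -/
def emb2AB : AB → Sig2
  | AB.a => Sig2.a
  | AB.b => Sig2.b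

/-- Embedding of `{a',b'}` into `Σ₂`. -/
def emb2ABP : ABP → Sig2
  | ABP.ap => Sig2.ap
  | ABP.bp => Sig2.bp

/-- The word `x₁ $^{|x₁|} x₂ $^{|x₂|} ⋯ x_k $^{|x_k|}` over `Σ₁`. -/
def encode1 (xs : List (List AB)) : List Sig1 :=
  (xs.map (fun x => x.map emb1AB ++ List.replicate x.length Sig1.dollar)).flatten

/-- The word `x₁ $^{|x₁|} x₂ $^{|x₂|} ⋯ x_k $^{|x_k|}` over `Σ₂`. -/
def encode2 (xs : List (List AB)) : List Sig2 :=
  (xs.map (fun x => x.map emb2AB ++ List.replicate x.length Sig2.dollar)).flatten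

/-- No `x_i` is a proper prefix of `x_j` for `1 ≤ j < i ≤ k`. -/
def PrefixCond (xs : List (List AB)) : Prop :=
  ∀ i j : Fin xs.length, (j : ℕ) < (i : ℕ) →
    ¬(xs.get i <+: xs.get j ∧ xs.get i ≠ xs.get j)

/-- The language `L̃_h` over `Σ₁`. -/
def LtildeH : Set (List Sig1) :=
  { w | ∃ (xs : List (List AB)) (y : List Alpha),
      w = encode1 xs ++ Sig1.sharp :: y.map emb1Alpha ∧
      PrefixCond xs ∧
      ∃ x ∈ xs, x = hHom y }

/-- The language `L̃_p` over `Σ₂`. -/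
def LtildeP : Set (List Sig2) :=
  { w | ∃ (xs : List (List AB)) (y : List ABP),
      w = encode2 xs ++ Sig2.sharp :: y.map emb2ABP ∧
      PrefixCond xs ∧
      ∃ x ∈ xs, x = y.map h1Letter }

/-- The homomorphism `h₂ : Σ₁* → Σ₂*` on letters: `h₂(α₀)=a'a'`, `h₂(α₁)=a'b'`,
`h₂(α₂)=b'a'`, `h₂(α₃)=b'b'`, and `h₂` is the identity on `{a, b, $, ♯}`. -/
def h2Letter : Sig1 → List Sig2
  | Sig1.α0 => [Sig2.ap, Sig2.ap]
  | Sig1.α1 => [Sig2.ap, Sig2.bp]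
  | Sig1.α2 => [Sig2.bp, Sig2.ap]
  | Sig1.α3 => [Sig2.bp, Sig2.bp]
  | Sig1.a => [Sig2.a]
  | Sig1.b => [Sig2.b]
  | Sig1.dollar => [Sig2.dollar]
  | Sig1.sharp => [Sig2.sharp]

/-- The homomorphism `h₂ : Σ₁* → Σ₂*`. -/
def h2Hom (w : List Sig1) : List Sig2 := w.flatMap h2Letter

/-- The priming map `a ↦ a'`, `b ↦ b'`, inverse to `h₁`. -/
def primed : AB → ABP
  | AB.a => ABP.ap
  | AB.b => ABP.bp

theorem h1Letter_primed (c : AB) : h1Letter (primed c) = c := by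
  cases c <;> rfl

theorem emb2ABP_injective : Function.Injective emb2ABP := by
  intro c d h
  cases c <;> cases d <;> first | rfl | cases h

theorem h2Hom_append (u v : List Sig1) : h2Hom (u ++ v) = h2Hom u ++ h2Hom v := by
  simp [h2Hom]

theorem h2Hom_map_emb1AB (x : List AB) : h2Hom (x.map emb1AB) = x.map emb2AB := by
  induction x with
  | nil => rfl
  | cons c x ih => cases c <;> simpa [h2Hom, h2Letter, emb1AB, emb2AB] using ih

theorem h2Hom_replicate_dollar (n : ℕ) :
    h2Hom (List.replicate n Sig1.dollar) = List.replicate n Sig2.dollar := by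
  induction n with
  | zero => rfl
  | succ n ih => simpa [h2Hom, h2Letter, List.replicate_succ] using ih

theorem h2Hom_encode1 (xs : List (List AB)) : h2Hom (encode1 xs) = encode2 xs := by
  induction xs with
  | nil => rfl
  | cons x xs ih =>
    change h2Hom ((x.map emb1AB ++ List.replicate x.length Sig1.dollar) ++ encode1 xs) =
      (x.map emb2AB ++ List.replicate x.length Sig2.dollar) ++ encode2 xs
    rw [h2Hom_append, h2Hom_append, h2Hom_map_emb1AB, h2Hom_replicate_dollar, ih]

theorem h2Hom_map_emb1Alpha (y : List Alpha) :
    h2Hom (y.map emb1Alpha) = ((hHom y).map primed).map emb2ABP := by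
  induction y with
  | nil => rfl
  | cons c y ih =>
    cases c <;>
      simpa [h2Hom, h2Letter, emb1Alpha, hHom, hLetter, primed, emb2ABP] using ih

theorem not_alpha_of_mem_encode1 {xs : List (List AB)} {c : Sig1} (hc : c ∈ encode1 xs) :
    c ∉ Set.range emb1Alpha := by
  simp only [encode1, List.mem_flatten, List.mem_map] at hc
  obtain ⟨_, ⟨x, -, rfl⟩, hc⟩ := hc
  rintro ⟨d, rfl⟩
  rcases List.mem_append.1 hc with h | h
  · obtain ⟨e, -, he⟩ := List.mem_map.1 h
    cases d <;> cases e <;> cases he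
  · have hd := List.eq_of_mem_replicate h
    cases d <;> cases hd

/-- A letter outside `{α₀, …, α₃}` can be read off from the front of the image under `h₂`. -/
theorem eq_cons_of_h2Hom_eq {w : List Sig1} {c : Sig1} {r : List Sig2}
    (hc : c ∉ Set.range emb1Alpha) (h : h2Hom w = h2Letter c ++ r) :
    ∃ v, w = c :: v ∧ h2Hom v = r := by
  cases w with
  | nil =>
    cases c <;> cases h
  | cons d v =>
    have h' : h2Letter d ++ h2Hom v = h2Letter c ++ r := h
    refine ⟨v, ?_⟩
    cases c
    case α0 => exact (hc ⟨.α0, rfl⟩).elim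
    case α1 => exact (hc ⟨.α1, rfl⟩).elim
    case α2 => exact (hc ⟨.α2, rfl⟩).elim
    case α3 => exact (hc ⟨.α3, rfl⟩).elim
    all_goals cases d <;> simp_all [h2Letter]

theorem eq_append_of_h2Hom_eq {p : List Sig1} {r : List Sig2}
    (hp : ∀ c ∈ p, c ∉ Set.range emb1Alpha) {w : List Sig1} (h : h2Hom w = h2Hom p ++ r) :
    ∃ v, w = p ++ v ∧ h2Hom v = r := by
  induction p generalizing w with
  | nil => exact ⟨w, rfl, h⟩
  | cons c p ih =>
    have h' : h2Hom w = h2Letter c ++ (h2Hom p ++ r) := by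
      rw [h, ← List.append_assoc]; rfl
    obtain ⟨u, rfl, hu⟩ := eq_cons_of_h2Hom_eq (hp c List.mem_cons_self) h'
    obtain ⟨v, rfl, hv⟩ := ih (fun d hd => hp d (List.mem_cons_of_mem c hd)) hu
    exact ⟨v, rfl, hv⟩

theorem exists_map_emb1Alpha_of_forall_mem {v : List Sig1}
    (hv : ∀ s ∈ h2Hom v, s ∈ Set.range emb2ABP) : ∃ y : List Alpha, v = y.map emb1Alpha := by
  have key : ∀ c ∈ v, c ∈ Set.range emb1Alpha := by
    intro c hc
    have hs : ∀ s ∈ h2Letter c, s ∈ Set.range emb2ABP := fun s hs =>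
      hv s (List.mem_flatMap.2 ⟨c, hc, hs⟩)
    cases c
    case α0 => exact ⟨.α0, rfl⟩
    case α1 => exact ⟨.α1, rfl⟩
    case α2 => exact ⟨.α2, rfl⟩
    case α3 => exact ⟨.α3, rfl⟩
    all_goals
      obtain ⟨d, hd⟩ := hs _ List.mem_cons_self
      cases d <;> cases hd
  obtain ⟨y, hy⟩ : v ∈ Set.range (List.map emb1Alpha) := by
    rw [Set.range_list_map]
    exact key
  exact ⟨y, hy.symm⟩

theorem map_h1Letter_map_primed (x : List AB) : (x.map primed).map h1Letter = x := by
  simp [Function.comp_def, h1Letter_primed]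

/-- `h₂⁻¹(L̃_p) = L̃_h`, i.e. for every word `w ∈ Σ₁*`,
`h₂(w) ∈ L̃_p` if and only if `w ∈ L̃_h`. -/
theorem h2_preimage_LtildeP : h2Hom ⁻¹' LtildeP = LtildeH := by
  ext w
  constructor
  · rintro ⟨xs, y, hw, hxs, x, hx, rfl⟩
    rw [← h2Hom_encode1] at hw
    obtain ⟨u, rfl, hu⟩ := eq_append_of_h2Hom_eq (fun _ hc => not_alpha_of_mem_encode1 hc) hw
    obtain ⟨v, rfl, hv⟩ := eq_cons_of_h2Hom_eq (c := Sig1.sharp)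
      (by rintro ⟨d, hd⟩; cases d <;> cases hd) hu
    obtain ⟨z, rfl⟩ := exists_map_emb1Alpha_of_forall_mem (v := v) (by
      rw [hv]
      intro s hs
      obtain ⟨d, -, hd⟩ := List.mem_map.1 hs
      exact ⟨d, hd⟩)
    rw [h2Hom_map_emb1Alpha] at hv
    obtain rfl := emb2ABP_injective.list_map hv
    exact ⟨xs, z, rfl, hxs, _, hx, map_h1Letter_map_primed _⟩
  · rintro ⟨xs, y, rfl, hxs, x, hx, rfl⟩
    refine ⟨xs, (hHom y).map primed, ?_, hxs, _, hx, (map_h1Letter_map_primed _).symm⟩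
    rw [h2Hom_append, h2Hom_encode1, ← h2Hom_map_emb1Alpha]
    rfl
end
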